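/- Assume μ₊ ≤ 0 and μ₋ > 0, and set a₁ := 2·ln(θ₁⁻/θ₂⁻)/(θ₂⁻ + θ₁⁻) (which is positive since θ₁⁻ > θ₂⁻ when μ₋ > 0). Then g is concave on (0, min(a₁,a)) and convex on (min(a₁,a), ∞). -/

import Mathlib

open Real Set Filter

/-- A function obtained by gluing two differentiable functions at `a`, with matching values and
derivatives, is convex on `(b, ∞)` if the derivatives are monotone on `(b, a]` and `[a, ∞)`. -/
theorem convexOn_Ioi_of_glue {f f₁ f₂ d₁ d₂ : ℝ → ℝ} {a b : ℝ}
    (h₁ : ∀ x, HasDerivAt f₁ (d₁ x) x) (h₂ : ∀ x, HasDerivAt f₂ (d₂ x) x)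
    (hf₁ : ∀ x ≤ a, f x = f₁ x) (hf₂ : ∀ x, a ≤ x → f x = f₂ x) (hd : d₁ a = d₂ a)
    (hm₁ : MonotoneOn d₁ (Ioc b a)) (hm₂ : MonotoneOn d₂ (Ici a)) :
    ConvexOn ℝ (Ioi b) f := by
  have hl : ∀ x < a, HasDerivAt f (d₁ x) x := fun x hx =>
    (h₁ x).congr_of_eventuallyEq <| by
      filter_upwards [Iio_mem_nhds hx] with y hy using hf₁ y (le_of_lt hy)
  have hr : ∀ x, a < x → HasDerivAt f (d₂ x) x := fun x hx =>
    (h₂ x).congr_of_eventuallyEq <| by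
      filter_upwards [Ioi_mem_nhds hx] with y hy using hf₂ y (le_of_lt hy)
  have hc : HasDerivAt f (d₁ a) a := by
    have hL : HasDerivWithinAt f (d₁ a) (Iic a) a :=
      (h₁ a).hasDerivWithinAt.congr (fun y hy => hf₁ y hy) (hf₁ a le_rfl)
    have hR : HasDerivWithinAt f (d₁ a) (Ici a) a := by
      rw [hd]
      exact (h₂ a).hasDerivWithinAt.congr (fun y hy => hf₂ y hy) (hf₂ a le_rfl)
    have := hL.union hR
    rwa [Iic_union_Ici, hasDerivWithinAt_univ] at this
  have hle : ∀ x ≤ a, HasDerivAt f (d₁ x) x := fun x hx => by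
    rcases hx.lt_or_eq with h | rfl
    exacts [hl x h, hc]
  have hdiff : Differentiable ℝ f := fun x => by
    rcases le_or_gt x a with h | h
    exacts [(hle x h).differentiableAt, (hr x h).differentiableAt]
  refine MonotoneOn.convexOn_of_deriv (convex_Ioi b) hdiff.continuous.continuousOn
    hdiff.differentiableOn ?_
  rw [interior_Ioi]
  intro x hx y hy hxy
  rw [mem_Ioi] at hx hy
  rcases le_or_gt y a with hya | hya
  · rw [(hle x (hxy.trans hya)).deriv, (hle y hya).deriv]
    exact hm₁ ⟨hx, hxy.trans hya⟩ ⟨hy, hya⟩ hxy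
  · rw [(hr y hya).deriv]
    rcases le_or_gt x a with hxa | hxa
    · rw [(hle x hxa).deriv]
      calc d₁ x ≤ d₁ a := hm₁ ⟨hx, hxa⟩ ⟨hx.trans_le hxa, le_rfl⟩ hxa
        _ = d₂ a := hd
        _ ≤ d₂ y := hm₂ self_mem_Ici hya.le hya.le
    · rw [(hr x hxa).deriv]
      exact hm₂ hxa.le hya.le hxy

theorem hasDerivAt_exp_add_exp (A B r s c x : ℝ) :
    HasDerivAt (fun x => A * exp (r * (x - c)) + B * exp (s * (x - c)))
      (A * r * exp (r * (x - c)) + B * s * exp (s * (x - c))) x := by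
  have h : ∀ t : ℝ, HasDerivAt (fun x => exp (t * (x - c))) (exp (t * (x - c)) * (t * 1)) x :=
    fun t => (((hasDerivAt_id x).sub_const c).const_mul t).exp
  exact (((h r).const_mul A).add ((h s).const_mul B)).congr_deriv (by ring)

/-- The characteristic roots are positive. -/
theorem sqrt_add_div_pos {m q s : ℝ} (hq : 0 < q) (hs : 0 < s) :
    0 < (√(m ^ 2 + 2 * q * s ^ 2) + m) / s ^ 2 := by
  have h : |m| < √(m ^ 2 + 2 * q * s ^ 2) := by
    rw [← sqrt_sq_eq_abs]
    exact sqrt_lt_sqrt (sq_nonneg m) (by linarith [show 0 < 2 * q * s ^ 2 by positivity])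
  exact div_pos (by linarith [neg_abs_le m]) (by positivity)

theorem sqrt_sub_div_pos {m q s : ℝ} (hq : 0 < q) (hs : 0 < s) :
    0 < (√(m ^ 2 + 2 * q * s ^ 2) - m) / s ^ 2 := by
  simpa [sub_eq_add_neg] using sqrt_add_div_pos (m := -m) hq hs

/-- The sign of the second derivative of `exp (s * x) - exp (-r * x)` changes at
`2 * log (r / s) / (s + r)`. -/
theorem sq_mul_exp_le_sq_mul_exp_iff {r s : ℝ} (hr : 0 < r) (hs : 0 < s) (x : ℝ) :
    r ^ 2 * exp (-r * x) ≤ s ^ 2 * exp (s * x) ↔ 2 * log (r / s) / (s + r) ≤ x := by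
  rw [← log_le_log_iff (by positivity) (by positivity), log_mul (by positivity) (by positivity),
    log_mul (by positivity) (by positivity), log_exp, log_exp, log_pow, log_pow,
    div_le_iff₀ (by positivity), log_div hr.ne' hs.ne']
  push_cast
  constructor <;> intro h <;> linarith

theorem statement11
    (a q μp μm σp σm : ℝ)
    (ha : 0 < a) (hq : 0 < q) (hσp : 0 < σp) (hσm : 0 < σm)
    (θ1p θ2p θ1m θ2m cm cp : ℝ)
    (hθ1p : θ1p = (Real.sqrt (μp ^ 2 + 2 * q * σp ^ 2) + μp) / σp ^ 2)
    (hθ2p : θ2p = (Real.sqrt (μp ^ 2 + 2 * q * σp ^ 2) - μp) / σp ^ 2)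
    (hθ1m : θ1m = (Real.sqrt (μm ^ 2 + 2 * q * σm ^ 2) + μm) / σm ^ 2)
    (hθ2m : θ2m = (Real.sqrt (μm ^ 2 + 2 * q * σm ^ 2) - μm) / σm ^ 2)
    (hcm : cm = (θ1m - θ1p) / (θ2m + θ1m))
    (hcp : cp = (θ2p - θ2m) / (θ2p + θ1p))
    (gm gp g : ℝ → ℝ)
    (hgm : ∀ x, gm x = if a < x then Real.exp (-θ1p * (x - a))
      else cm * Real.exp (θ2m * (x - a)) + (1 - cm) * Real.exp (-θ1m * (x - a)))
    (hgp : ∀ x, gp x = if a < x then (1 - cp) * Real.exp (θ2p * (x - a)) + cp * Real.exp (-θ1p * (x - a))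
      else Real.exp (θ2m * (x - a)))
    (hg : ∀ x, g x = gp x * gm 0 - gm x * gp 0)
    (hμp : μp ≤ 0) (hμm : 0 < μm)
    (a₁ : ℝ)
    (ha₁ : a₁ = 2 * Real.log (θ1m / θ2m) / (θ2m + θ1m))
    :
    ConcaveOn ℝ (Set.Ioo 0 (min a₁ a)) g ∧ ConvexOn ℝ (Set.Ioi (min a₁ a)) g := by
  have p1p : 0 < θ1p := hθ1p ▸ sqrt_add_div_pos hq hσp
  have p2p : 0 < θ2p := hθ2p ▸ sqrt_sub_div_pos hq hσp
  have p1m : 0 < θ1m := hθ1m ▸ sqrt_add_div_pos hq hσm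
  have p2m : 0 < θ2m := hθ2m ▸ sqrt_sub_div_pos hq hσm
  have hle : θ1p ≤ θ2p := by
    rw [hθ1p, hθ2p]
    exact div_le_div_of_nonneg_right (by linarith) (by positivity)
  have hcm1 : 1 - cm = (θ2m + θ1p) / (θ2m + θ1m) := by rw [hcm]; field_simp; ring
  have hcp1 : 1 - cp = (θ1p + θ2m) / (θ2p + θ1p) := by rw [hcp]; field_simp; ring
  have hcmP : cm * (θ2m + θ1m) = θ1m - θ1p := by rw [hcm]; field_simp
  have hcpQ : cp * (θ2p + θ1p) = θ2p - θ2m := by rw [hcp]; field_simp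
  have hcmpos : 0 < 1 - cm := by rw [hcm1]; positivity
  have hcppos : 0 < 1 - cp := by rw [hcp1]; positivity
  have hgm0 : gm 0 = cm * exp (-θ2m * a) + (1 - cm) * exp (θ1m * a) := by
    rw [hgm, if_neg ha.not_gt]; ring_nf
  have hgp0 : gp 0 = exp (-θ2m * a) := by
    rw [hgp, if_neg ha.not_gt]; ring_nf
  set E := exp (-θ2m * a) with hE
  set F := exp (θ1m * a) with hF
  have hEpos : 0 < E := exp_pos _
  have hFpos : 0 < F := exp_pos _
  have hEF : E ≤ F := exp_le_exp.2 (by linarith [mul_pos p1m ha, mul_pos p2m ha])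
  have hgm0E : E ≤ gm 0 := by linarith [mul_nonneg hcmpos.le (sub_nonneg.2 hEF)]
  set K := (1 - cm) * (E * F) with hK
  have hKpos : 0 < K := by positivity
  set f₁ : ℝ → ℝ := fun x => K * exp (θ2m * (x - 0)) + -K * exp (-θ1m * (x - 0)) with hf₁
  set f₂ : ℝ → ℝ := fun x => gm 0 * (1 - cp) * exp (θ2p * (x - a)) +
    (gm 0 * cp - E) * exp (-θ1p * (x - a)) with hf₂
  have e2 : ∀ x, exp (θ2m * (x - a)) = exp (θ2m * x) * E := fun x => by
    rw [hE, ← exp_add]; ring_nf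
  have e1 : ∀ x, exp (-θ1m * (x - a)) = exp (-θ1m * x) * F := fun x => by
    rw [hF, ← exp_add]; ring_nf
  have hg₁ : ∀ x ≤ a, g x = f₁ x := fun x hx => by
    rw [hg, hgp x, hgm x, if_neg hx.not_gt, if_neg hx.not_gt, hgm0, hgp0, e1, e2]
    simp only [hf₁, hK, sub_zero]
    ring
  have hg₂ : ∀ x, a ≤ x → g x = f₂ x := fun x hx => by
    rcases hx.lt_or_eq with h | rfl
    · rw [hg, hgp x, hgm x, if_pos h, if_pos h, hgp0]
      simp only [hf₂]
      ring
    · rw [hg, hgp a, hgm a, if_neg (lt_irrefl a), if_neg (lt_irrefl a), hgp0]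
      simp only [hf₂, sub_self, mul_zero, exp_zero]
      ring
  have hd₁ := hasDerivAt_exp_add_exp K (-K) θ2m (-θ1m) 0
  have hd₂ := hasDerivAt_exp_add_exp (gm 0 * (1 - cp)) (gm 0 * cp - E) θ2p (-θ1p) a
  have hdd₁ := hasDerivAt_exp_add_exp (K * θ2m) (-K * -θ1m) θ2m (-θ1m) 0
  have hdd₂ := hasDerivAt_exp_add_exp (gm 0 * (1 - cp) * θ2p) ((gm 0 * cp - E) * -θ1p)
    θ2p (-θ1p) a
  have hsign : ∀ x, θ1m ^ 2 * exp (-θ1m * x) ≤ θ2m ^ 2 * exp (θ2m * x) ↔ a₁ ≤ x := fun x => by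
    rw [sq_mul_exp_le_sq_mul_exp_iff p1m p2m, ha₁]
  constructor
  · have hconc : ConcaveOn ℝ (Ioo 0 (min a₁ a)) f₁ := by
      refine concaveOn_of_hasDerivWithinAt2_nonpos (convex_Ioo _ _)
        (Continuous.continuousOn (by fun_prop)) (fun x _ => (hd₁ x).hasDerivWithinAt)
        (fun x _ => (hdd₁ x).hasDerivWithinAt) fun x hx => ?_
      rw [interior_Ioo] at hx
      have := not_le.1 (mt (hsign x).1 (not_le.2 (hx.2.trans_le (min_le_left _ _))))
      rw [sub_zero]
      linarith [mul_le_mul_of_nonneg_left this.le hKpos.le]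
    exact hconc.congr fun x hx => (hg₁ x (hx.2.le.trans (min_le_right _ _))).symm
  · refine convexOn_Ioi_of_glue hd₁ hd₂ hg₁ hg₂ ?_ ?_ ?_
    · have ea : exp (θ2m * a) * E = 1 := by rw [← e2, sub_self, mul_zero, exp_zero]
      have eb : exp (-θ1m * a) * F = 1 := by rw [← e1, sub_self, mul_zero, exp_zero]
      simp only [sub_zero, sub_self, mul_zero, exp_zero, mul_one]
      calc K * θ2m * exp (θ2m * a) + -K * -θ1m * exp (-θ1m * a)
          = (1 - cm) * (F * θ2m * (exp (θ2m * a) * E) + E * θ1m * (exp (-θ1m * a) * F)) := by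
            rw [hK]; ring
        _ = (1 - cm) * (F * θ2m + E * θ1m) := by rw [ea, eb]; ring
        _ = gm 0 * (1 - cp) * θ2p + (gm 0 * cp - E) * -θ1p := by
            linear_combination gm 0 * hcpQ - E * hcmP - θ2m * hgm0
    · refine monotoneOn_of_hasDerivWithinAt_nonneg (convex_Ioc _ _)
        (Continuous.continuousOn (by fun_prop)) (fun x _ => (hdd₁ x).hasDerivWithinAt)
        fun x hx => ?_
      rw [interior_Ioc] at hx
      have := (hsign x).2 (le_of_lt ((min_lt_iff.1 hx.1).resolve_right hx.2.not_gt))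
      rw [sub_zero]
      linarith [mul_le_mul_of_nonneg_left this hKpos.le]
    · refine monotoneOn_of_hasDerivWithinAt_nonneg (convex_Ici _)
        (Continuous.continuousOn (by fun_prop)) (fun x _ => (hdd₂ x).hasDerivWithinAt)
        fun x hx => ?_
      rw [interior_Ici, mem_Ioi] at hx
      have hexp : exp (-θ1p * (x - a)) ≤ exp (θ2p * (x - a)) :=
        exp_le_exp.2 (by linarith [mul_pos p1p (sub_pos.2 hx), mul_pos p2p (sub_pos.2 hx)])
      have hsq : θ1p ^ 2 ≤ θ2p ^ 2 := by gcongr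
      have hmul : θ1p ^ 2 * exp (-θ1p * (x - a)) ≤ θ2p ^ 2 * exp (θ2p * (x - a)) := by gcongr
      have hA : 0 ≤ gm 0 * (1 - cp) := mul_nonneg (hEpos.le.trans hgm0E) hcppos.le
      have h1 := mul_le_mul_of_nonneg_left hmul hA
      have h2 : 0 ≤ (gm 0 - E) * (θ1p ^ 2 * exp (-θ1p * (x - a))) :=
        mul_nonneg (sub_nonneg.2 hgm0E) (by positivity)
      linarith
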